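/- Fix real μ, ν. For i ∈ {1,2} and every j ∈ ℤ, and likewise for i ∈ {3,4} and every j ∈ ℤ when μ is a positive odd integer, one has for all x > 0 the recurrence (2j+μ+1)·(θ + (μ+ν+2)/2)Λ_{i,j}^{μ,ν}(x) = (j+1)(j+μ+1)·Λ_{i,j+1}^{μ,ν}(x) − (j+(μ+ν)/2)·(j+(μ−ν)/2)·Λ_{i,j−1}^{μ,ν}(x). -/

import Mathlib

noncomputable section

open Set MeasureTheory Filter Topology

/-- The Euler operator `θ = x·d/dx` acting on real-valued functions on `ℝ`. -/
def eulerOp (u : ℝ → ℝ) : ℝ → ℝ := fun x => x * deriv u x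

/-- The operator `(θ + a)(θ + b) − x²` applied to `v`. -/
def quadOp (a b : ℝ) (v : ℝ → ℝ) : ℝ → ℝ := fun x =>
  eulerOp (fun y => eulerOp v y + b * v y) x
    + a * (eulerOp v x + b * v x) - x ^ 2 * v x

/-- The fourth-order operator `D_{μ,ν} = x⁻²((θ+μ+ν)(θ+μ) − x²)(θ(θ+ν) − x²)`. -/
def Dop (μ ν : ℝ) (u : ℝ → ℝ) : ℝ → ℝ := fun x =>
  quadOp (μ + ν) μ (quadOp 0 ν u) x / x ^ 2

/-- The normalized I-Bessel function `Ĩ_α(z) = Σ (z/2)^{2n}/(n!·Γ(n+α+1))`. -/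
def tildeI (α z : ℝ) : ℝ :=
  ∑' n : ℕ, (z / 2) ^ (2 * n) / ((n.factorial : ℝ) * Real.Gamma ((n : ℝ) + α + 1))

/-- The K-Bessel function `K_α(z) = ∫₀^∞ e^{−z·cosh s}·cosh(α·s) ds`. -/
def besselK (α z : ℝ) : ℝ :=
  ∫ s in Ioi (0 : ℝ), Real.exp (-z * Real.cosh s) * Real.cosh (α * s)

/-- The normalized K-Bessel function `K̃_α(z) = (z/2)^{−α}·K_α(z)`. -/
def tildeK (α z : ℝ) : ℝ := (z / 2) ^ (-α) * besselK α z

/-- The generating function `G₁^{μ,ν}(t,x)`. -/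
def genG₁ (μ ν t x : ℝ) : ℝ :=
  (1 - t) ^ (-(μ + ν + 2) / 2) * tildeI (μ / 2) (t * x / (1 - t)) * tildeI (ν / 2) (x / (1 - t))

/-- The generating function `G₂^{μ,ν}(t,x)`. -/
def genG₂ (μ ν t x : ℝ) : ℝ :=
  (1 - t) ^ (-(μ + ν + 2) / 2) * tildeI (μ / 2) (t * x / (1 - t)) * tildeK (ν / 2) (x / (1 - t))

/-- The generating function `G₃^{μ,ν}(t,x)`. -/
def genG₃ (μ ν t x : ℝ) : ℝ :=
  (1 - t) ^ (-(μ + ν + 2) / 2) * tildeK (μ / 2) (t * x / (1 - t)) * tildeI (ν / 2) (x / (1 - t))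

/-- The generating function `G₄^{μ,ν}(t,x)`. -/
def genG₄ (μ ν t x : ℝ) : ℝ :=
  (1 - t) ^ (-(μ + ν + 2) / 2) * tildeK (μ / 2) (t * x / (1 - t)) * tildeK (ν / 2) (x / (1 - t))

/-- `Λ₁ⱼ^{μ,ν}(x) = (1/j!)·(∂/∂t)^j|₀ G₁^{μ,ν}(t,x)`. -/
def Lambda₁ (μ ν : ℝ) (j : ℕ) (x : ℝ) : ℝ :=
  iteratedDeriv j (fun t => genG₁ μ ν t x) 0 / (j.factorial : ℝ)

/-- `Λ₂ⱼ^{μ,ν}(x) = (1/j!)·(∂/∂t)^j|₀ G₂^{μ,ν}(t,x)`. -/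
def Lambda₂ (μ ν : ℝ) (j : ℕ) (x : ℝ) : ℝ :=
  iteratedDeriv j (fun t => genG₂ μ ν t x) 0 / (j.factorial : ℝ)

/-- `Λ₁ⱼ` for integer `j`, vanishing for `j < 0`. -/
def Lambda₁Z (μ ν : ℝ) (j : ℤ) (x : ℝ) : ℝ :=
  if 0 ≤ j then Lambda₁ μ ν j.toNat x else 0

/-- `Λ₂ⱼ` for integer `j`, vanishing for `j < 0`. -/
def Lambda₂Z (μ ν : ℝ) (j : ℤ) (x : ℝ) : ℝ :=
  if 0 ≤ j then Lambda₂ μ ν j.toNat x else 0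

/-- For `μ = m` a positive odd integer, `Λ₃ⱼ^{μ,ν}(x) = (1/(j+μ)!)·(∂/∂t)^{j+μ}|₀ [tᵐ·G₃]`,
the derivative at `0` being the limit from the right of the `(j+μ)`-th derivative of the
real-analytic function `t ↦ tᵐ·G₃^{m,ν}(t,x)` on `(0,1)`; it vanishes for `j < −μ`. -/
def Lambda₃ (m : ℕ) (ν : ℝ) (j : ℤ) (x : ℝ) : ℝ :=
  if -(m : ℤ) ≤ j then
    limUnder (𝓝[>] (0 : ℝ))
        (fun t => iteratedDeriv (j + (m : ℤ)).toNat (fun s => s ^ m * genG₃ (m : ℝ) ν s x) t) /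
      (((j + (m : ℤ)).toNat.factorial : ℝ))
  else 0

/-- For `μ = m` a positive odd integer, `Λ₄ⱼ^{μ,ν}(x) = (1/(j+μ)!)·(∂/∂t)^{j+μ}|₀ [tᵐ·G₄]`,
vanishing for `j < −μ`. -/
def Lambda₄ (m : ℕ) (ν : ℝ) (j : ℤ) (x : ℝ) : ℝ :=
  if -(m : ℤ) ≤ j then
    limUnder (𝓝[>] (0 : ℝ))
        (fun t => iteratedDeriv (j + (m : ℤ)).toNat (fun s => s ^ m * genG₄ (m : ℝ) ν s x) t) /
      (((j + (m : ℤ)).toNat.factorial : ℝ))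
  else 0

open scoped ContDiff

/-- The `k`-th Taylor coefficient at `0`. -/
def taylorCoeff (k : ℕ) (h : ℝ → ℝ) : ℝ := iteratedDeriv k h 0 / (k.factorial : ℝ)

theorem ContDiffAt.deriv_of_infty {h : ℝ → ℝ} {x : ℝ} (hh : ContDiffAt ℝ ∞ h x) :
    ContDiffAt ℝ ∞ (deriv h) x :=
  (hh.fderiv_right (m := ∞) (by simp)).clm_apply contDiffAt_const

theorem ContDiffAt.iteratedDeriv_of_infty {h : ℝ → ℝ} {x : ℝ} (hh : ContDiffAt ℝ ∞ h x) (k : ℕ) :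
    ContDiffAt ℝ ∞ (iteratedDeriv k h) x := by
  induction k with
  | zero => simpa using hh
  | succ k ih => rw [iteratedDeriv_succ]; exact ih.deriv_of_infty

theorem ContDiffAt.nat_of_infty {h : ℝ → ℝ} {x : ℝ} (hh : ContDiffAt ℝ ∞ h x) (k : ℕ) :
    ContDiffAt ℝ k h x := hh.of_le (by exact_mod_cast le_top)

theorem contDiffAt_self_mul {f : ℝ → ℝ} {x : ℝ} (hf : ContDiffAt ℝ ∞ f x) :
    ContDiffAt ℝ ∞ (fun t => t * f t) x := contDiffAt_id.mul hf

namespace taylorCoeff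

theorem congr {f g : ℝ → ℝ} (h : f =ᶠ[𝓝 0] g) (k : ℕ) : taylorCoeff k f = taylorCoeff k g := by
  rw [taylorCoeff, taylorCoeff, h.iteratedDeriv_eq]

theorem add {f g : ℝ → ℝ} (hf : ContDiffAt ℝ ∞ f 0) (hg : ContDiffAt ℝ ∞ g 0) (k : ℕ) :
    taylorCoeff k (fun t => f t + g t) = taylorCoeff k f + taylorCoeff k g := by
  rw [taylorCoeff, iteratedDeriv_fun_add (hf.nat_of_infty k) (hg.nat_of_infty k), add_div]
  rfl

theorem const_mul {f : ℝ → ℝ} (c : ℝ) (k : ℕ) :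
    taylorCoeff k (fun t => c * f t) = c * taylorCoeff k f := by
  rw [taylorCoeff, iteratedDeriv_const_mul_field, mul_div_assoc, taylorCoeff]

theorem deriv (f : ℝ → ℝ) (k : ℕ) :
    taylorCoeff k (deriv f) = (k + 1) * taylorCoeff (k + 1) f := by
  rw [taylorCoeff, taylorCoeff, iteratedDeriv_succ', Nat.factorial_succ]
  push_cast
  field_simp

theorem zero_id_mul (f : ℝ → ℝ) : taylorCoeff 0 (fun t => t * f t) = 0 := by
  simp [taylorCoeff]

theorem succ_id_mul {f : ℝ → ℝ} (hf : ContDiffAt ℝ ∞ f 0) (k : ℕ) :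
    taylorCoeff (k + 1) (fun t => t * f t) = taylorCoeff k f := by
  induction k generalizing f with
  | zero =>
    have h := (hasDerivAt_id' (0 : ℝ)).fun_mul (hf.differentiableAt (by simp)).hasDerivAt
    simpa [taylorCoeff] using h.deriv
  | succ k ih =>
    have hd : _root_.deriv (fun t => t * f t) =ᶠ[𝓝 0] fun t => f t + t * _root_.deriv f t := by
      filter_upwards [(hf.nat_of_infty 1).eventually (by simp)] with t ht
      have h := (hasDerivAt_id' t).fun_mul (ht.differentiableAt (by simp)).hasDerivAt
      simpa using h.deriv
    have h1 := deriv (fun t => t * f t) (k + 1)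
    rw [congr hd, add hf (contDiffAt_self_mul hf.deriv_of_infty), ih hf.deriv_of_infty,
      deriv] at h1
    push_cast at h1
    have : (k : ℝ) + 1 + 1 ≠ 0 := by positivity
    apply mul_left_cancel₀ this
    linear_combination -h1

theorem id_mul_deriv {f : ℝ → ℝ} (hf : ContDiffAt ℝ ∞ f 0) (k : ℕ) :
    taylorCoeff k (fun t => t * _root_.deriv f t) = k * taylorCoeff k f := by
  cases k with
  | zero => simp [zero_id_mul]
  | succ k => rw [succ_id_mul hf.deriv_of_infty, deriv]; push_cast; rfl

theorem id_mul_id_mul_deriv_deriv {f : ℝ → ℝ} (hf : ContDiffAt ℝ ∞ f 0) (k : ℕ) :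
    taylorCoeff k (fun t => t * (t * _root_.deriv (_root_.deriv f) t))
      = k * (k - 1) * taylorCoeff k f := by
  cases k with
  | zero => simp [zero_id_mul]
  | succ k =>
    rw [succ_id_mul (contDiffAt_self_mul hf.deriv_of_infty.deriv_of_infty),
      id_mul_deriv hf.deriv_of_infty, deriv]
    push_cast
    ring

end taylorCoeff

theorem hasDerivAt_iteratedDeriv_param {U : Set (ℝ × ℝ)} (hU : IsOpen U) {F : ℝ × ℝ → ℝ}
    (hF : ContDiffOn ℝ ∞ F U) (k : ℕ) {t x : ℝ} (hp : (t, x) ∈ U) :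
    HasDerivAt (fun y => iteratedDeriv k (fun s => F (s, y)) t)
      (iteratedDeriv k (fun s => deriv (fun y => F (s, y)) x) t) x := by
  have fst {F : ℝ × ℝ → ℝ} (hF : ContDiffOn ℝ ∞ F U) {t x : ℝ} (hp : (t, x) ∈ U) :
      HasDerivAt (fun s => F (s, x)) (fderiv ℝ F (t, x) (1, 0)) t := by
    have h1 := ((hF.contDiffAt (hU.mem_nhds hp)).differentiableAt (by simp)).hasFDerivAt
    exact h1.comp_hasDerivAt t ((hasDerivAt_id t).prodMk (hasDerivAt_const t x))
  have snd {F : ℝ × ℝ → ℝ} (hF : ContDiffOn ℝ ∞ F U) {t x : ℝ} (hp : (t, x) ∈ U) :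
      HasDerivAt (fun y => F (t, y)) (fderiv ℝ F (t, x) (0, 1)) x := by
    have h1 := ((hF.contDiffAt (hU.mem_nhds hp)).differentiableAt (by simp)).hasFDerivAt
    exact h1.comp_hasDerivAt x ((hasDerivAt_const x t).prodMk (hasDerivAt_id x))
  have smooth {F : ℝ × ℝ → ℝ} (hF : ContDiffOn ℝ ∞ F U) (v : ℝ × ℝ) :
      ContDiffOn ℝ ∞ (fun p => fderiv ℝ F p v) U :=
    (hF.fderiv_of_isOpen hU (by simp)).clm_apply contDiffOn_const
  have nhds_fst {t x : ℝ} (hp : (t, x) ∈ U) : ∀ᶠ s in 𝓝 t, (s, x) ∈ U :=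
    (Continuous.prodMk_left x).continuousAt.eventually (hU.mem_nhds hp)
  have nhds_snd {t x : ℝ} (hp : (t, x) ∈ U) : ∀ᶠ y in 𝓝 x, (t, y) ∈ U :=
    (Continuous.prodMk_right t).continuousAt.eventually (hU.mem_nhds hp)
  induction k generalizing F with
  | zero => simpa using (snd hF hp).differentiableAt.hasDerivAt
  | succ k ih =>
    have key := ih (smooth hF (1, 0))
    have e1 : (fun y => iteratedDeriv (k + 1) (fun s => F (s, y)) t) =ᶠ[𝓝 x]
        fun y => iteratedDeriv k (fun s => fderiv ℝ F (s, y) (1, 0)) t := by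
      filter_upwards [nhds_snd hp] with y hy
      rw [iteratedDeriv_succ']
      apply Filter.EventuallyEq.iteratedDeriv_eq
      filter_upwards [nhds_fst hy] with s hs
      exact (fst hF hs).deriv
    have e2 : deriv (fun s => deriv (fun y => F (s, y)) x) =ᶠ[𝓝 t]
        fun s => deriv (fun y => fderiv ℝ F (s, y) (1, 0)) x := by
      filter_upwards [nhds_fst hp] with s hs
      have e3 : (fun s => deriv (fun y => F (s, y)) x) =ᶠ[𝓝 s]
          fun s => fderiv ℝ F (s, x) (0, 1) := by
        filter_upwards [nhds_fst hs] with r hr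
        exact (snd hF hr).deriv
      have hc := hF.contDiffAt (hU.mem_nhds hs)
      have hd : DifferentiableAt ℝ (fderiv ℝ F) (s, x) :=
        (hc.fderiv_right (m := ∞) (by simp)).differentiableAt (by simp)
      have hs2 := hc.isSymmSndFDerivAt (by
        rw [minSmoothness_of_isRCLikeNormedField]; exact WithTop.coe_le_coe.2 le_top)
      rw [e3.deriv_eq, (fst (smooth hF (0, 1)) hs).deriv, (snd (smooth hF (1, 0)) hs).deriv,
        fderiv_clm_apply hd (differentiableAt_const _),
        fderiv_clm_apply hd (differentiableAt_const _)]
      simpa using hs2 _ _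
    rw [iteratedDeriv_succ', e2.iteratedDeriv_eq]
    exact key.congr_of_eventuallyEq e1

/-- The generating function built from arbitrary functions `A`, `B` and exponent `-c`. -/
def bilinearGen (A B : ℝ → ℝ) (c t x : ℝ) : ℝ :=
  (1 - t) ^ (-c) * A (t * x / (1 - t)) * B (x / (1 - t))

section bilinearGen

variable {A B : ℝ → ℝ}

theorem contDiffOn_bilinearGen (hA : ContDiff ℝ ∞ A) (hB : ContDiffOn ℝ ∞ B (Ioi 0)) (c : ℝ) :
    ContDiffOn ℝ ∞ (fun p : ℝ × ℝ => bilinearGen A B c p.1 p.2) (Iio 1 ×ˢ Ioi 0) := by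
  have h1 : ContDiffOn ℝ ∞ (fun p : ℝ × ℝ => 1 - p.1) (Iio 1 ×ˢ Ioi 0) := by fun_prop
  have hpos : ∀ p ∈ (Iio 1 ×ˢ Ioi 0 : Set (ℝ × ℝ)), 0 < 1 - p.1 := fun p hp => sub_pos.2 hp.1
  have hne : ∀ p ∈ (Iio 1 ×ˢ Ioi 0 : Set (ℝ × ℝ)), 1 - p.1 ≠ 0 := fun p hp => (hpos p hp).ne'
  have hz : ContDiffOn ℝ ∞ (fun p : ℝ × ℝ => p.2 / (1 - p.1)) (Iio 1 ×ˢ Ioi 0) :=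
    contDiffOn_snd.div h1 hne
  refine ((h1.rpow_const_of_ne hne).mul (hA.comp_contDiffOn
    ((contDiffOn_fst.mul contDiffOn_snd).div h1 hne))).mul (hB.comp hz fun p hp => ?_)
  exact div_pos (mem_Ioi.1 hp.2) (hpos p hp)

theorem contDiffAt_bilinearGen_fst (hA : ContDiff ℝ ∞ A) (hB : ContDiffOn ℝ ∞ B (Ioi 0)) (c : ℝ)
    {t x : ℝ} (ht : t < 1) (hx : 0 < x) :
    ContDiffAt ℝ ∞ (fun s => bilinearGen A B c s x) t :=
  ((contDiffOn_bilinearGen hA hB c).contDiffAt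
    ((isOpen_Iio.prod isOpen_Ioi).mem_nhds (show (t, x) ∈ _ from ⟨ht, hx⟩))).comp
    (f := fun s : ℝ => (s, x)) t (contDiffAt_id.prodMk contDiffAt_const)

theorem rpow_neg_add_one {s : ℝ} (hs : 0 < s) (c : ℝ) : s ^ (-(c + 1)) = s ^ (-c) / s := by
  rw [neg_add, ← sub_eq_add_neg, Real.rpow_sub_one hs.ne']

theorem rpow_neg_add_two {s : ℝ} (hs : 0 < s) (c : ℝ) : s ^ (-(c + 2)) = s ^ (-c) / s ^ 2 := by
  rw [neg_add, ← sub_eq_add_neg, Real.rpow_sub hs, Real.rpow_two]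

theorem hasDerivAt_bilinearGen_fst (hA : Differentiable ℝ A) (hB : DifferentiableOn ℝ B (Ioi 0))
    (c : ℝ) {t x : ℝ} (ht : t < 1) (hx : 0 < x) :
    HasDerivAt (fun s => bilinearGen A B c s x)
      (c * bilinearGen A B (c + 1) t x + x * bilinearGen (deriv A) B (c + 2) t x
        + x * bilinearGen A (deriv B) (c + 2) t x) t := by
  have h0 : 0 < 1 - t := sub_pos.2 ht
  have hz : 0 < x / (1 - t) := div_pos hx h0
  have h1 : HasDerivAt (fun s : ℝ => 1 - s) (-1) t := (hasDerivAt_id' t).const_sub 1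
  have hr := h1.rpow_const (p := -c) (Or.inl h0.ne')
  have hw : HasDerivAt (fun s : ℝ => s * x / (1 - s)) (x / (1 - t) ^ 2) t :=
    (((hasDerivAt_id' t).mul_const x).fun_div h1 h0.ne').congr_deriv (by ring)
  have hzd : HasDerivAt (fun s : ℝ => x / (1 - s)) (x / (1 - t) ^ 2) t :=
    ((hasDerivAt_const t x).fun_div h1 h0.ne').congr_deriv (by ring)
  have hA' := (hA (t * x / (1 - t))).hasDerivAt.comp t hw
  have hB' := (hB.differentiableAt (Ioi_mem_nhds hz)).hasDerivAt.comp t hzd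
  refine ((hr.fun_mul hA').fun_mul hB').congr_deriv ?_
  simp only [bilinearGen, rpow_neg_add_one h0, rpow_neg_add_two h0, Real.rpow_sub_one h0.ne',
    Function.comp_apply]
  ring

theorem hasDerivAt_bilinearGen_snd (hA : Differentiable ℝ A) (hB : DifferentiableOn ℝ B (Ioi 0))
    (c : ℝ) {t x : ℝ} (ht : t < 1) (hx : 0 < x) :
    HasDerivAt (fun y => bilinearGen A B c t y)
      (t * bilinearGen (deriv A) B (c + 1) t x + bilinearGen A (deriv B) (c + 1) t x) x := by
  have h0 : 0 < 1 - t := sub_pos.2 ht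
  have hz : 0 < x / (1 - t) := div_pos hx h0
  have hw : HasDerivAt (fun y : ℝ => t * y / (1 - t)) (t / (1 - t)) x :=
    (((hasDerivAt_id' x).const_mul t).div_const (1 - t)).congr_deriv (by ring)
  have hzd : HasDerivAt (fun y : ℝ => y / (1 - t)) (1 / (1 - t)) x :=
    (hasDerivAt_id' x).div_const (1 - t)
  have hA' := (hA (t * x / (1 - t))).hasDerivAt.comp x hw
  have hB' := (hB.differentiableAt (Ioi_mem_nhds hz)).hasDerivAt.comp x hzd
  refine ((hA'.const_mul ((1 - t) ^ (-c))).fun_mul hB').congr_deriv ?_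
  simp only [bilinearGen, rpow_neg_add_one h0, Function.comp_apply]
  ring

/-- The partial differential equation in `t` and `x` satisfied by `bilinearGen A B c` when `A` and
`B` solve modified Bessel equations. -/
theorem bilinearGen_pde {μ ν : ℝ} (hA : ContDiff ℝ ∞ A) (hB : ContDiffOn ℝ ∞ B (Ioi 0))
    (odeA : ∀ w, w * deriv (deriv A) w + (μ + 1) * deriv A w = w * A w)
    (odeB : ∀ z, 0 < z → z * deriv (deriv B) z + (ν + 1) * deriv B z = z * B z)
    {c : ℝ} (hc : c = (μ + ν + 2) / 2) {x : ℝ} (hx : 0 < x) {g e : ℝ → ℝ}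
    (hg : g = fun t => bilinearGen A B c t x)
    (he : e = fun t => x * deriv (fun y => bilinearGen A B c t y) x + c * g t)
    {t : ℝ} (ht : t < 1) :
    2 * (t * deriv e t) + (μ + 1) * e t
        + t * (t * (t * deriv (deriv g) t) + (μ + 3) * (t * deriv g t)
          + (1 + (μ + ν) / 2) * (1 + (μ - ν) / 2) * g t)
      = t * deriv (deriv g) t + (μ + 1) * deriv g t := by
  have hA1 : ContDiff ℝ ∞ (deriv A) := (contDiff_infty_iff_deriv.1 hA).2
  have hB1 : ContDiffOn ℝ ∞ (deriv B) (Ioi 0) :=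
    ((contDiffOn_infty_iff_deriv_of_isOpen isOpen_Ioi).1 hB).2
  have dA := hA.differentiable (by simp)
  have dA1 := hA1.differentiable (by simp)
  have dB := hB.differentiableOn (by simp)
  have dB1 := hB1.differentiableOn (by simp)
  have g1 : ∀ s < 1, deriv g s = c * bilinearGen A B (c + 1) s x
      + x * bilinearGen (deriv A) B (c + 2) s x + x * bilinearGen A (deriv B) (c + 2) s x :=
    fun s hs => by rw [hg]; exact (hasDerivAt_bilinearGen_fst dA dB c hs hx).deriv
  have e0 : ∀ s < 1, e s = x * (s * bilinearGen (deriv A) B (c + 1) s x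
      + bilinearGen A (deriv B) (c + 1) s x) + c * bilinearGen A B c s x := fun s hs => by
    simp only [he, hg, (hasDerivAt_bilinearGen_snd dA dB c hs hx).deriv]
  have near : ∀ᶠ s in 𝓝 t, s < 1 := Iio_mem_nhds ht
  have g2 := ((((hasDerivAt_bilinearGen_fst dA dB (c + 1) ht hx).const_mul c).fun_add
    ((hasDerivAt_bilinearGen_fst dA1 dB (c + 2) ht hx).const_mul x)).fun_add
    ((hasDerivAt_bilinearGen_fst dA dB1 (c + 2) ht hx).const_mul x)).congr_of_eventuallyEq
    (near.mono g1) |>.deriv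
  have e1 := (((((hasDerivAt_id' t).fun_mul
    (hasDerivAt_bilinearGen_fst dA1 dB (c + 1) ht hx)).fun_add
    (hasDerivAt_bilinearGen_fst dA dB1 (c + 1) ht hx)).const_mul x).fun_add
    ((hasDerivAt_bilinearGen_fst dA dB c ht hx).const_mul c)).congr_of_eventuallyEq
    (near.mono e0) |>.deriv
  rw [g2, e1, g1 t ht, e0 t ht, hg]
  have h0 : 0 < 1 - t := sub_pos.2 ht
  have hz : 0 < x / (1 - t) := div_pos hx h0
  have oA := odeA (t * x / (1 - t))
  have oB := odeB _ hz
  have a1 : c + 1 + 1 = c + 2 := by ring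
  have a2 : c + 1 + 2 = c + 2 + 1 := by ring
  simp only [bilinearGen, a1, a2, rpow_neg_add_one h0, rpow_neg_add_two h0]
  generalize A (t * x / (1 - t)) = A0 at *
  generalize deriv A (t * x / (1 - t)) = A1 at *
  generalize deriv (deriv A) (t * x / (1 - t)) = A2 at *
  generalize B (x / (1 - t)) = B0 at *
  generalize deriv B (x / (1 - t)) = B1 at *
  generalize deriv (deriv B) (x / (1 - t)) = B2 at *
  generalize (1 - t) ^ (-c) = r at *
  obtain ⟨s, rfl⟩ : ∃ s, t = 1 - s := ⟨1 - t, by ring⟩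
  simp only [sub_sub_cancel] at *
  have hs : s ≠ 0 := h0.ne'
  subst hc
  field_simp at oA oB ⊢
  linear_combination (-4 * r * x * s ^ 2 * B0) * oA + 4 * r * x * (1 - s) * s ^ 2 * A0 * oB

theorem hasDerivAt_taylorCoeff_bilinearGen (hA : ContDiff ℝ ∞ A) (hB : ContDiffOn ℝ ∞ B (Ioi 0))
    (c : ℝ) {x : ℝ} (hx : 0 < x) (k : ℕ) :
    HasDerivAt (fun y => taylorCoeff k (fun t => bilinearGen A B c t y))
      (taylorCoeff k (fun t => deriv (fun y => bilinearGen A B c t y) x)) x :=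
  (hasDerivAt_iteratedDeriv_param (isOpen_Iio.prod isOpen_Ioi) (contDiffOn_bilinearGen hA hB c) k
    (show ((0 : ℝ), x) ∈ _ from ⟨zero_lt_one' ℝ, hx⟩)).div_const _

theorem taylorCoeff_bilinearGen_recurrence {μ ν : ℝ} (hA : ContDiff ℝ ∞ A)
    (hB : ContDiffOn ℝ ∞ B (Ioi 0))
    (odeA : ∀ w, w * deriv (deriv A) w + (μ + 1) * deriv A w = w * A w)
    (odeB : ∀ z, 0 < z → z * deriv (deriv B) z + (ν + 1) * deriv B z = z * B z)
    {c : ℝ} (hc : c = (μ + ν + 2) / 2) {x : ℝ} (hx : 0 < x) (k : ℕ) :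
    (2 * (k : ℝ) + μ + 1) * (x * deriv (fun y => taylorCoeff k (fun t => bilinearGen A B c t y)) x
        + c * taylorCoeff k (fun t => bilinearGen A B c t x))
      = ((k : ℝ) + 1) * ((k : ℝ) + μ + 1) * taylorCoeff (k + 1) (fun t => bilinearGen A B c t x)
        - ((k : ℝ) + (μ + ν) / 2) * ((k : ℝ) + (μ - ν) / 2)
          * taylorCoeff k (fun t => t * bilinearGen A B c t x) := by
  set g : ℝ → ℝ := fun t => bilinearGen A B c t x with hg
  set d : ℝ → ℝ := fun t => deriv (fun y => bilinearGen A B c t y) x with hd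
  set e : ℝ → ℝ := fun t => x * d t + c * g t with he
  have hA1 : ContDiff ℝ ∞ (deriv A) := (contDiff_infty_iff_deriv.1 hA).2
  have hB1 : ContDiffOn ℝ ∞ (deriv B) (Ioi 0) :=
    ((contDiffOn_infty_iff_deriv_of_isOpen isOpen_Ioi).1 hB).2
  have near : ∀ᶠ s : ℝ in 𝓝 0, s < 1 := Iio_mem_nhds one_pos
  have sg : ContDiffAt ℝ ∞ g 0 := contDiffAt_bilinearGen_fst hA hB c one_pos hx
  have sd : ContDiffAt ℝ ∞ d 0 :=
    ((contDiffAt_self_mul (contDiffAt_bilinearGen_fst hA1 hB (c + 1) one_pos hx)).add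
      (contDiffAt_bilinearGen_fst hA hB1 (c + 1) one_pos hx)).congr_of_eventuallyEq
    (near.mono fun s hs => (hasDerivAt_bilinearGen_snd (hA.differentiable (by simp))
      (hB.differentiableOn (by simp)) c hs hx).deriv)
  have se : ContDiffAt ℝ ∞ e 0 := (contDiffAt_const.mul sd).add (contDiffAt_const.mul sg)
  have Te : taylorCoeff k e = x * taylorCoeff k d + c * taylorCoeff k g := by
    rw [he, taylorCoeff.add (contDiffAt_const.mul sd) (contDiffAt_const.mul sg),
      taylorCoeff.const_mul, taylorCoeff.const_mul]
  have s1 := sg.deriv_of_infty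
  have s2 := s1.deriv_of_infty
  have sF : ContDiffAt ℝ ∞ (fun t => t * (t * deriv (deriv g) t) + (μ + 3) * (t * deriv g t)
      + (1 + (μ + ν) / 2) * (1 + (μ - ν) / 2) * g t) 0 :=
    ((contDiffAt_self_mul (contDiffAt_self_mul s2)).add
      (contDiffAt_const.mul (contDiffAt_self_mul s1))).add (contDiffAt_const.mul sg)
  have sed : ContDiffAt ℝ ∞ (fun t => t * deriv e t) 0 := contDiffAt_self_mul se.deriv_of_infty
  have sgd : ContDiffAt ℝ ∞ (fun t => t * deriv g t) 0 := contDiffAt_self_mul s1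
  have sgd2 : ContDiffAt ℝ ∞ (fun t => t * deriv (deriv g) t) 0 := contDiffAt_self_mul s2
  have pde := taylorCoeff.congr (near.mono fun t ht =>
    bilinearGen_pde hA hB odeA odeB hc hx hg he ht) k
  have shift : taylorCoeff k (fun t => t * (t * (t * deriv (deriv g) t) + (μ + 3) * (t * deriv g t)
      + (1 + (μ + ν) / 2) * (1 + (μ - ν) / 2) * g t))
      = ((k : ℝ) + (μ + ν) / 2) * ((k : ℝ) + (μ - ν) / 2)
        * taylorCoeff k (fun t => t * g t) := by
    cases k with
    | zero => simp [taylorCoeff.zero_id_mul]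
    | succ k =>
      rw [taylorCoeff.succ_id_mul sF, taylorCoeff.succ_id_mul sg, taylorCoeff.add
        ((contDiffAt_self_mul sgd2).add (contDiffAt_const.mul sgd)) (contDiffAt_const.mul sg),
        taylorCoeff.add (contDiffAt_self_mul sgd2) (contDiffAt_const.mul sgd),
        taylorCoeff.const_mul, taylorCoeff.const_mul, taylorCoeff.id_mul_deriv sg,
        taylorCoeff.id_mul_id_mul_deriv_deriv sg]
      push_cast
      ring
  rw [taylorCoeff.add ((contDiffAt_const.mul sed).add (contDiffAt_const.mul se))
    (contDiffAt_self_mul sF), taylorCoeff.add (contDiffAt_const.mul sed) (contDiffAt_const.mul se),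
    taylorCoeff.add sgd2 (contDiffAt_const.mul s1), taylorCoeff.const_mul, taylorCoeff.const_mul,
    taylorCoeff.const_mul, taylorCoeff.id_mul_deriv se, taylorCoeff.id_mul_deriv s1,
    taylorCoeff.deriv, Te] at pde
  rw [(hasDerivAt_taylorCoeff_bilinearGen hA hB c hx k).deriv]
  linear_combination pde - shift

end bilinearGen

theorem contDiffOn_of_ladder {f : ℝ → ℝ → ℝ} {S : Set ℝ} (hS : IsOpen S) {σ : ℝ}
    (hf : ∀ α, ∀ z ∈ S, HasDerivAt (f α) (σ * (z / 2) * f (α + 1) z) z) (α : ℝ) :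
    ContDiffOn ℝ ∞ (f α) S := by
  rw [contDiffOn_infty]
  intro n
  induction n generalizing α with
  | zero =>
    exact contDiffOn_zero.2 fun z hz => (hf α z hz).continuousAt.continuousWithinAt
  | succ n ih =>
    push_cast
    rw [contDiffOn_succ_iff_deriv_of_isOpen hS]
    refine ⟨fun z hz => (hf α z hz).differentiableAt.differentiableWithinAt, by simp, ?_⟩
    have h : ContDiffOn ℝ n (fun z => σ * (z / 2) * f (α + 1) z) S :=
      ContDiffOn.mul (by fun_prop) (ih (α + 1))
    exact h.congr fun z hz => (hf α z hz).deriv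

theorem ode_of_ladder {f : ℝ → ℝ → ℝ} {S : Set ℝ} (hS : IsOpen S) {σ : ℝ} (hσ : σ * σ = 1)
    (hf : ∀ α, ∀ z ∈ S, HasDerivAt (f α) (σ * (z / 2) * f (α + 1) z) z)
    (hrec : ∀ α, ∀ z ∈ S, f (α - 1) z = (z / 2) ^ 2 * f (α + 1) z + σ * α * f α z)
    (α : ℝ) {z : ℝ} (hz : z ∈ S) :
    z * deriv (deriv (f α)) z + (2 * α + 1) * deriv (f α) z = z * f α z := by
  have h1 : deriv (f α) =ᶠ[𝓝 z] fun z => σ * (z / 2) * f (α + 1) z := by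
    filter_upwards [hS.mem_nhds hz] with w hw using (hf α w hw).deriv
  have h2 := (((hasDerivAt_id' z).div_const 2).const_mul σ).fun_mul (hf (α + 1) z hz)
  have h3 := hrec (α + 1) z hz
  rw [add_sub_cancel_right] at h3
  rw [h1.deriv_eq, h2.deriv, (hf α z hz).deriv, h3]
  linear_combination (z * (z / 2) ^ 2 * f (α + 1 + 1) z) * hσ

theorem inv_Gamma_eq (s : ℝ) : (Real.Gamma s)⁻¹ = s * (Real.Gamma (s + 1))⁻¹ := by
  rcases eq_or_ne s 0 with rfl | hs
  · simp
  · rcases eq_or_ne (Real.Gamma s) 0 with h | h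
    · rw [Real.Gamma_add_one hs, h]; simp
    · rw [Real.Gamma_add_one hs]; field_simp

theorem exists_bound_inv_Gamma (α : ℝ) :
    ∃ C, ∀ n : ℕ, |(Real.Gamma ((n : ℝ) + α + 1))⁻¹| ≤ C := by
  obtain ⟨N, hN⟩ := exists_nat_ge (-α)
  have anti : ∀ n, |(Real.Gamma (((N + n : ℕ) : ℝ) + α + 1))⁻¹|
      ≤ |(Real.Gamma ((N : ℝ) + α + 1))⁻¹| := by
    intro n
    induction n with
    | zero => simp
    | succ n ih =>
      refine le_trans ?_ ih
      have h1 : 1 ≤ ((N + n : ℕ) : ℝ) + α + 1 := by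
        push_cast
        have : (0 : ℝ) ≤ n := n.cast_nonneg
        linarith
      rw [inv_Gamma_eq (((N + n : ℕ) : ℝ) + α + 1), abs_mul, abs_of_pos (zero_lt_one.trans_le h1),
        show ((N + (n + 1) : ℕ) : ℝ) + α + 1 = ((N + n : ℕ) : ℝ) + α + 1 + 1 by
          push_cast; ring]
      exact le_mul_of_one_le_left (abs_nonneg _) h1
  obtain ⟨C, hC⟩ := (Set.finite_range
    (fun i : Fin (N + 1) => |(Real.Gamma ((i : ℕ) + α + 1))⁻¹|)).bddAbove
  refine ⟨C, fun n => ?_⟩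
  rcases lt_or_ge n (N + 1) with h | h
  · exact hC ⟨⟨n, h⟩, rfl⟩
  · obtain ⟨m, rfl⟩ := Nat.exists_eq_add_of_le (by omega : N ≤ n)
    exact (anti m).trans (hC ⟨⟨N, by omega⟩, rfl⟩)

/-- The entire function `u ↦ Σ uⁿ/(n!·Γ(n+α+1))`, for which `Ĩ_α(z)` is the value at `(z/2)²`. -/
def besselClifford (α u : ℝ) : ℝ :=
  ∑' n : ℕ, u ^ n * ((n.factorial : ℝ)⁻¹ * (Real.Gamma ((n : ℝ) + α + 1))⁻¹)

theorem tildeI_eq (α z : ℝ) : tildeI α z = besselClifford α ((z / 2) ^ 2) := by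
  simp only [tildeI, besselClifford, pow_mul, div_eq_mul_inv, mul_inv]

theorem summable_besselClifford (α u : ℝ) :
    Summable fun n : ℕ => u ^ n * ((n.factorial : ℝ)⁻¹ * (Real.Gamma ((n : ℝ) + α + 1))⁻¹) := by
  obtain ⟨C, hC⟩ := exists_bound_inv_Gamma α
  refine Summable.of_norm_bounded ((Real.summable_pow_div_factorial |u|).mul_left C) fun n => ?_
  rw [Real.norm_eq_abs, abs_mul, abs_mul, abs_pow,
    abs_of_pos (by positivity : (0 : ℝ) < (n.factorial : ℝ)⁻¹)]
  have : 0 ≤ |u| ^ n * (n.factorial : ℝ)⁻¹ := by positivity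
  calc _ = (|u| ^ n * (n.factorial : ℝ)⁻¹) * |(Real.Gamma ((n : ℝ) + α + 1))⁻¹| := by ring
    _ ≤ (|u| ^ n * (n.factorial : ℝ)⁻¹) * C := mul_le_mul_of_nonneg_left (hC n) this
    _ = _ := by ring

theorem besselClifford_sub_one (α u : ℝ) :
    besselClifford (α - 1) u = u * besselClifford (α + 1) u + α * besselClifford α u := by
  have hterm : ∀ n : ℕ, u ^ n * ((n.factorial : ℝ)⁻¹ * (Real.Gamma ((n : ℝ) + (α - 1) + 1))⁻¹)
      = n * (u ^ n * ((n.factorial : ℝ)⁻¹ * (Real.Gamma ((n : ℝ) + α + 1))⁻¹))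
        + α * (u ^ n * ((n.factorial : ℝ)⁻¹ * (Real.Gamma ((n : ℝ) + α + 1))⁻¹)) := fun n => by
    rw [show (n : ℝ) + (α - 1) + 1 = n + α by ring, inv_Gamma_eq]
    ring
  have hshift : ∀ n : ℕ, ((n + 1 : ℕ) : ℝ) * (u ^ (n + 1) * (((n + 1).factorial : ℝ)⁻¹ *
      (Real.Gamma (((n + 1 : ℕ) : ℝ) + α + 1))⁻¹))
      = u * (u ^ n * ((n.factorial : ℝ)⁻¹ * (Real.Gamma ((n : ℝ) + (α + 1) + 1))⁻¹)) := fun n => by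
    rw [Nat.factorial_succ, show ((n + 1 : ℕ) : ℝ) + α + 1 = n + (α + 1) + 1 by push_cast; ring]
    push_cast
    field_simp
    ring
  have h1 := (summable_besselClifford (α + 1) u).mul_left u
  simp_rw [← hshift] at h1
  have h2 := (summable_nat_add_iff (f := fun n : ℕ => (n : ℝ) * (u ^ n * ((n.factorial : ℝ)⁻¹ *
    (Real.Gamma ((n : ℝ) + α + 1))⁻¹))) 1).1 h1
  rw [besselClifford, tsum_congr hterm, h2.tsum_add ((summable_besselClifford α u).mul_left α),
    h2.tsum_eq_zero_add, tsum_congr hshift, tsum_mul_left, tsum_mul_left]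
  simp [besselClifford]

theorem hasDerivAt_besselClifford (α u : ℝ) :
    HasDerivAt (besselClifford α) (besselClifford (α + 1) u) u := by
  obtain ⟨C, hC⟩ := exists_bound_inv_Gamma α
  have hC0 : 0 ≤ C := (abs_nonneg _).trans (hC 0)
  set R := |u| + 1 with hR
  have hR0 : 0 < R := by positivity
  have hshift : ∀ n : ℕ, ((n + 1 : ℕ) : ℝ) * ((n + 1).factorial : ℝ)⁻¹ = (n.factorial : ℝ)⁻¹ :=
    fun n => by
      rw [Nat.factorial_succ]
      push_cast
      field_simp
  have hsum : Summable fun n : ℕ => (n : ℝ) * R ^ (n - 1) * ((n.factorial : ℝ)⁻¹ * C) := by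
    rw [← summable_nat_add_iff 1]
    refine ((Real.summable_pow_div_factorial R).mul_left C).congr fun n => ?_
    rw [add_tsub_cancel_right, div_eq_mul_inv, ← hshift]
    ring
  have key := hasDerivAt_tsum_of_isPreconnected hsum Metric.isOpen_ball
    (convex_ball (0 : ℝ) R).isPreconnected
    (g := fun (n : ℕ) v => v ^ n * ((n.factorial : ℝ)⁻¹ * (Real.Gamma ((n : ℝ) + α + 1))⁻¹))
    (g' := fun (n : ℕ) v => n * v ^ (n - 1) *
      ((n.factorial : ℝ)⁻¹ * (Real.Gamma ((n : ℝ) + α + 1))⁻¹))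
    (fun n v _ => (hasDerivAt_pow n v).mul_const _) (fun n v hv => ?_)
    (Metric.mem_ball_self hR0) (summable_besselClifford α 0)
    (y := u) (by simp [hR])
  · refine key.congr_deriv ?_
    have hs : Summable fun n : ℕ => (n : ℝ) * u ^ (n - 1) *
        ((n.factorial : ℝ)⁻¹ * (Real.Gamma ((n : ℝ) + α + 1))⁻¹) := by
      rw [← summable_nat_add_iff 1]
      refine (summable_besselClifford (α + 1) u).congr fun n => ?_
      rw [add_tsub_cancel_right, ← hshift,
        show ((n + 1 : ℕ) : ℝ) + α + 1 = n + (α + 1) + 1 by push_cast; ring]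
      ring
    rw [hs.tsum_eq_zero_add, besselClifford]
    simp only [Nat.cast_zero, zero_mul, zero_add]
    refine tsum_congr fun n => ?_
    rw [add_tsub_cancel_right, ← hshift n,
      show ((n + 1 : ℕ) : ℝ) + α + 1 = n + (α + 1) + 1 by push_cast; ring]
    ring
  · have hv' : |v| ≤ R := by simpa using (Metric.mem_ball.1 hv).le
    rw [Real.norm_eq_abs, abs_mul, abs_mul, abs_mul, abs_pow, Nat.abs_cast,
      abs_of_pos (by positivity : (0 : ℝ) < (n.factorial : ℝ)⁻¹)]
    gcongr
    exact hC n

theorem hasDerivAt_tildeI (α z : ℝ) :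
    HasDerivAt (tildeI α) (1 * (z / 2) * tildeI (α + 1) z) z := by
  have h := (hasDerivAt_besselClifford α ((z / 2) ^ 2)).comp z
    (((hasDerivAt_id' z).div_const 2).fun_pow 2)
  rw [show tildeI α = besselClifford α ∘ fun z => (z / 2) ^ 2 from funext fun z => tildeI_eq α z]
  refine h.congr_deriv ?_
  rw [tildeI_eq]
  push_cast
  ring

theorem tildeI_sub_one (α z : ℝ) :
    tildeI (α - 1) z = (z / 2) ^ 2 * tildeI (α + 1) z + 1 * α * tildeI α z := by
  rw [tildeI_eq, tildeI_eq, tildeI_eq, besselClifford_sub_one, one_mul]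

theorem contDiff_tildeI (α : ℝ) : ContDiff ℝ ∞ (tildeI α) :=
  contDiffOn_univ.1 (contDiffOn_of_ladder isOpen_univ (fun α z _ => hasDerivAt_tildeI α z) α)

theorem tildeI_ode (α z : ℝ) :
    z * deriv (deriv (tildeI α)) z + (2 * α + 1) * deriv (tildeI α) z = z * tildeI α z :=
  ode_of_ladder isOpen_univ (one_mul 1) (fun α z _ => hasDerivAt_tildeI α z)
    (fun α z _ => tildeI_sub_one α z) α (mem_univ z)

theorem exp_neg_mul_cosh_mul_exp_le {z : ℝ} (hz : 0 < z) (β s : ℝ) :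
    Real.exp (-z * Real.cosh s) * Real.exp (β * s) ≤ Real.exp (β ^ 2 / z) := by
  rw [← Real.exp_add, Real.exp_le_exp]
  have h1 : s ^ 2 / 4 ≤ Real.cosh s := by
    rw [← Real.cosh_abs, Real.cosh_eq, ← sq_abs]
    have h := Real.quadratic_le_exp_of_nonneg (abs_nonneg s)
    have := Real.exp_pos (-|s|)
    have := abs_nonneg s
    linarith
  have h2 : z * (s ^ 2 / 4) ≤ z * Real.cosh s := mul_le_mul_of_nonneg_left h1 hz.le
  have h3 : β ^ 2 / z - (β * s - z * (s ^ 2 / 4)) = (β - z * s / 2) ^ 2 / z := by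
    field_simp
    ring
  have h4 : 0 ≤ (β - z * s / 2) ^ 2 / z := by positivity
  linarith

theorem exp_neg_mul_cosh_mul_exp_abs_le {z : ℝ} (hz : 0 < z) (α : ℝ) {s : ℝ} (hs : 0 ≤ s) :
    Real.exp (-z * Real.cosh s) * Real.exp |α * s|
      ≤ Real.exp ((|α| + 1) ^ 2 / z) * Real.exp (-1 * s) := by
  have h := exp_neg_mul_cosh_mul_exp_le hz (|α| + 1) s
  calc _ = Real.exp (-z * Real.cosh s) * Real.exp ((|α| + 1) * s) * Real.exp (-1 * s) := by
        rw [mul_assoc, ← Real.exp_add ((|α| + 1) * s), abs_mul, abs_of_nonneg hs]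
        ring_nf
    _ ≤ _ := by gcongr

theorem abs_cosh_le_exp_abs (x : ℝ) : |Real.cosh x| ≤ Real.exp |x| := by
  rw [abs_of_pos (Real.cosh_pos x), ← Real.cosh_abs, ← Real.cosh_add_sinh]
  linarith [Real.sinh_nonneg_iff.2 (abs_nonneg x)]

theorem abs_sinh_le_exp_abs (x : ℝ) : |Real.sinh x| ≤ Real.exp |x| := by
  rw [Real.abs_sinh, ← Real.cosh_add_sinh]
  linarith [Real.cosh_pos |x|]

theorem integrableOn_besselK {z : ℝ} (hz : 0 < z) (α : ℝ) :
    IntegrableOn (fun s => Real.exp (-z * Real.cosh s) * Real.cosh (α * s)) (Ioi 0) := by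
  have hc : Continuous fun s => Real.exp (-z * Real.cosh s) * Real.cosh (α * s) := by
    have := Real.continuous_cosh
    fun_prop
  refine ((exp_neg_integrableOn_Ioi 0 one_pos).const_mul (Real.exp ((|α| + 1) ^ 2 / z))).mono'
    hc.aestronglyMeasurable ?_
  filter_upwards [ae_restrict_mem measurableSet_Ioi] with s hs
  rw [Real.norm_eq_abs, abs_mul, Real.abs_exp]
  exact (mul_le_mul_of_nonneg_left (abs_cosh_le_exp_abs _) (Real.exp_pos _).le).trans
    (exp_neg_mul_cosh_mul_exp_abs_le hz α (le_of_lt hs))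

theorem besselK_neg (α z : ℝ) : besselK (-α) z = besselK α z := by
  simp [besselK]

theorem cosh_mul_cosh_mul (α s : ℝ) : Real.cosh s * Real.cosh (α * s)
    = (Real.cosh ((α + 1) * s) + Real.cosh ((α - 1) * s)) / 2 := by
  rw [add_mul, sub_mul, one_mul, Real.cosh_add, Real.cosh_sub]
  ring

theorem sinh_mul_sinh_mul (α s : ℝ) : Real.sinh s * Real.sinh (α * s)
    = (Real.cosh ((α + 1) * s) - Real.cosh ((α - 1) * s)) / 2 := by
  rw [add_mul, sub_mul, one_mul, Real.cosh_add, Real.cosh_sub]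
  ring

theorem hasDerivAt_besselK (α : ℝ) {z : ℝ} (hz : 0 < z) :
    HasDerivAt (besselK α) (-(besselK (α + 1) z + besselK (α - 1) z) / 2) z := by
  have hprod : ∀ y s : ℝ, Real.exp (-y * Real.cosh s) * -Real.cosh s * Real.cosh (α * s)
      = -(1 / 2) * (Real.exp (-y * Real.cosh s) * Real.cosh ((α + 1) * s)
        + Real.exp (-y * Real.cosh s) * Real.cosh ((α - 1) * s)) := fun y s => by
    linear_combination (-Real.exp (-y * Real.cosh s)) * cosh_mul_cosh_mul α s
  have hint : ∀ {y : ℝ}, 0 < y → IntegrableOn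
      (fun s => Real.exp (-y * Real.cosh s) * -Real.cosh s * Real.cosh (α * s)) (Ioi 0) :=
    fun {y} hy => by
      simp_rw [hprod]
      exact ((integrableOn_besselK hy _).add (integrableOn_besselK hy _)).const_mul _
  have key := hasDerivAt_integral_of_dominated_loc_of_deriv_le (μ := volume.restrict (Ioi 0))
    (F := fun y s => Real.exp (-y * Real.cosh s) * Real.cosh (α * s))
    (F' := fun y s => Real.exp (-y * Real.cosh s) * -Real.cosh s * Real.cosh (α * s))
    (Ioi_mem_nhds (half_lt_self hz))
    (by
      filter_upwards [Ioi_mem_nhds hz] with y hy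
      exact (integrableOn_besselK hy α).aestronglyMeasurable)
    (integrableOn_besselK hz α) (hint hz).aestronglyMeasurable
    (bound := fun s => ‖Real.exp (-(z / 2) * Real.cosh s) * -Real.cosh s * Real.cosh (α * s)‖)
    (by
      refine Eventually.of_forall fun s y hy => ?_
      have h1 : z / 2 < y := hy
      have h2 := Real.cosh_pos s
      simp only [norm_mul]
      gcongr
      rw [Real.norm_eq_abs, Real.norm_eq_abs, Real.abs_exp, Real.abs_exp, Real.exp_le_exp]
      nlinarith)
    (hint (half_pos hz)).norm
    (by
      refine Eventually.of_forall fun s y _ => ?_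
      have h := (((hasDerivAt_id' y).fun_neg.mul_const (Real.cosh s)).exp).mul_const
        (Real.cosh (α * s))
      simpa using h)
  refine key.2.congr_deriv ?_
  simp_rw [hprod]
  rw [integral_const_mul, integral_add (integrableOn_besselK hz _) (integrableOn_besselK hz _)]
  simp only [besselK]
  ring

theorem besselK_add_one_sub (α : ℝ) {z : ℝ} (hz : 0 < z) :
    z * (besselK (α + 1) z - besselK (α - 1) z) = 2 * α * besselK α z := by
  have hprod : ∀ s : ℝ, Real.exp (-z * Real.cosh s) * (-z * Real.sinh s) * Real.sinh (α * s)
        + Real.exp (-z * Real.cosh s) * (Real.cosh (α * s) * α)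
      = -(z / 2) * (Real.exp (-z * Real.cosh s) * Real.cosh ((α + 1) * s))
        + (z / 2 * (Real.exp (-z * Real.cosh s) * Real.cosh ((α - 1) * s))
        + α * (Real.exp (-z * Real.cosh s) * Real.cosh (α * s))) := fun s => by
    linear_combination (-z * Real.exp (-z * Real.cosh s)) * sinh_mul_sinh_mul α s
  have i1 := (integrableOn_besselK hz (α + 1)).const_mul (-(z / 2))
  have i2 := (integrableOn_besselK hz (α - 1)).const_mul (z / 2)
  have i3 := (integrableOn_besselK hz α).const_mul α
  have i23 : IntegrableOn (fun s => z / 2 * (Real.exp (-z * Real.cosh s) * Real.cosh ((α - 1) * s))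
      + α * (Real.exp (-z * Real.cosh s) * Real.cosh (α * s))) (Ioi 0) := i2.add i3
  have hd : ∀ s ∈ Ici (0 : ℝ), HasDerivAt
      (fun s => Real.exp (-z * Real.cosh s) * Real.sinh (α * s))
      (-(z / 2) * (Real.exp (-z * Real.cosh s) * Real.cosh ((α + 1) * s))
        + (z / 2 * (Real.exp (-z * Real.cosh s) * Real.cosh ((α - 1) * s))
        + α * (Real.exp (-z * Real.cosh s) * Real.cosh (α * s)))) s := fun s _ => by
    rw [← hprod]
    have h := (((Real.hasDerivAt_cosh s).const_mul (-z)).exp).fun_mul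
      ((hasDerivAt_id' s).const_mul α).sinh
    simpa using h
  have hlim : Tendsto (fun s => Real.exp (-z * Real.cosh s) * Real.sinh (α * s)) atTop (𝓝 0) := by
    have h0 : Tendsto (fun s : ℝ => Real.exp ((|α| + 1) ^ 2 / z) * Real.exp (-1 * s)) atTop
        (𝓝 0) := by
      have : Tendsto (fun s : ℝ => Real.exp (-1 * s)) atTop (𝓝 0) := by
        simpa using Real.tendsto_exp_neg_atTop_nhds_zero
      simpa using this.const_mul (Real.exp ((|α| + 1) ^ 2 / z))
    refine squeeze_zero_norm' ?_ h0
    filter_upwards [eventually_ge_atTop 0] with s hs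
    rw [Real.norm_eq_abs, abs_mul, Real.abs_exp]
    exact (mul_le_mul_of_nonneg_left (abs_sinh_le_exp_abs _) (Real.exp_pos _).le).trans
      (exp_neg_mul_cosh_mul_exp_abs_le hz α hs)
  have key := integral_Ioi_of_hasDerivAt_of_tendsto' hd (i1.add i23) hlim
  rw [integral_add i1 i23, integral_add i2 i3, integral_const_mul, integral_const_mul,
    integral_const_mul] at key
  simp only [mul_zero, Real.sinh_zero, sub_zero] at key
  simp only [besselK]
  linear_combination -2 * key

theorem hasDerivAt_tildeK (α : ℝ) {z : ℝ} (hz : 0 < z) :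
    HasDerivAt (tildeK α) (-1 * (z / 2) * tildeK (α + 1) z) z := by
  have hz2 : 0 < z / 2 := half_pos hz
  have h := (((hasDerivAt_id' z).div_const 2).rpow_const (p := -α) (Or.inl hz2.ne')).fun_mul
    (hasDerivAt_besselK α hz)
  refine h.congr_deriv ?_
  have hrec := besselK_add_one_sub α hz
  rw [tildeK, rpow_neg_add_one hz2, Real.rpow_sub_one hz2.ne']
  field_simp
  linear_combination hrec

theorem tildeK_sub_one (α : ℝ) {z : ℝ} (hz : 0 < z) :
    tildeK (α - 1) z = (z / 2) ^ 2 * tildeK (α + 1) z + -1 * α * tildeK α z := by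
  have hz2 : 0 < z / 2 := half_pos hz
  have hrec := besselK_add_one_sub α hz
  have h1 := rpow_neg_add_one hz2 (α - 1)
  rw [sub_add_cancel, eq_div_iff hz2.ne'] at h1
  rw [tildeK, tildeK, tildeK, rpow_neg_add_one hz2, ← h1]
  field_simp
  linear_combination -hrec

theorem contDiffOn_tildeK (α : ℝ) : ContDiffOn ℝ ∞ (tildeK α) (Ioi 0) :=
  contDiffOn_of_ladder isOpen_Ioi (fun α _ hz => hasDerivAt_tildeK α hz) α

theorem tildeK_ode (α : ℝ) {z : ℝ} (hz : 0 < z) :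
    z * deriv (deriv (tildeK α)) z + (2 * α + 1) * deriv (tildeK α) z = z * tildeK α z :=
  ode_of_ladder isOpen_Ioi (by norm_num) (fun α _ hz => hasDerivAt_tildeK α hz)
    (fun α _ hz => tildeK_sub_one α hz) α hz

theorem tildeK_eq_tildeK_neg (α : ℝ) {z : ℝ} (hz : 0 < z) :
    tildeK α z = (z / 2) ^ (-(2 * α)) * tildeK (-α) z := by
  rw [tildeK, tildeK, besselK_neg, ← mul_assoc, ← Real.rpow_add (half_pos hz)]
  ring_nf

/-- The entire extension of `z ↦ K̃_{-(n+1/2)}(z)`, an exponential times a polynomial. -/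
def tildeKHalf : ℕ → ℝ → ℝ
  | 0 => fun z => Real.exp 1 * tildeK (-(1 / 2)) 1 * Real.exp (-z)
  | n + 1 => fun z => ((n : ℝ) + 1 / 2) * tildeKHalf n z - z / 2 * deriv (tildeKHalf n) z

theorem contDiff_tildeKHalf (n : ℕ) : ContDiff ℝ ∞ (tildeKHalf n) := by
  induction n with
  | zero => exact contDiff_const.mul (Real.contDiff_exp.comp contDiff_neg)
  | succ n ih =>
    exact (contDiff_const.mul ih).sub ((contDiff_id.div_const 2).mul
      (contDiff_infty_iff_deriv.1 ih).2)

theorem tildeKHalf_ode (n : ℕ) (z : ℝ) :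
    z * deriv (deriv (tildeKHalf n)) z + (-(2 * (n : ℝ) + 1) + 1) * deriv (tildeKHalf n) z
      = z * tildeKHalf n z := by
  induction n generalizing z with
  | zero =>
    have h : ∀ a : ℝ, deriv (fun z => a * Real.exp (-z)) = fun z => -a * Real.exp (-z) :=
      fun a => funext fun z => by
        simpa using (((hasDerivAt_id' z).fun_neg.exp).const_mul a).deriv
    rw [tildeKHalf, h, h]
    simp
  | succ n ih =>
    have d (w : ℝ) : HasDerivAt (tildeKHalf n) (deriv (tildeKHalf n) w) w :=
      ((contDiff_tildeKHalf n).differentiable (by simp) w).hasDerivAt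
    have d' (w : ℝ) : HasDerivAt (deriv (tildeKHalf n)) (deriv (deriv (tildeKHalf n)) w) w :=
      ((contDiff_infty_iff_deriv.1 (contDiff_tildeKHalf n)).2.differentiable
        (by simp) w).hasDerivAt
    have h1 : deriv (tildeKHalf (n + 1)) = fun w => -(w / 2) * tildeKHalf n w := funext fun w => by
      rw [tildeKHalf, (((d w).const_mul _).fun_sub
        (((hasDerivAt_id' w).div_const 2).fun_mul (d' w))).deriv]
      linear_combination -(1 / 2) * ih w
    rw [h1, (((hasDerivAt_id' z).div_const 2).fun_neg.fun_mul (d z)).deriv, tildeKHalf]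
    push_cast
    ring

theorem tildeKHalf_eq (n : ℕ) {z : ℝ} (hz : 0 < z) :
    tildeKHalf n z = tildeK (-((n : ℝ) + 1 / 2)) z := by
  induction n generalizing z with
  | zero =>
    have hd : ∀ w ∈ Ioi (0 : ℝ),
        HasDerivAt (fun w => Real.exp w * tildeK (-(1 / 2)) w) 0 w := fun w hw => by
      refine ((Real.hasDerivAt_exp w).fun_mul (hasDerivAt_tildeK _ hw)).congr_deriv ?_
      have hw2 : 0 < w / 2 := half_pos hw
      have h := tildeK_eq_tildeK_neg (1 / 2) hw
      rw [show -(2 * (1 / 2) : ℝ) = -1 by norm_num, Real.rpow_neg_one] at h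
      rw [show -(1 / 2 : ℝ) + 1 = 1 / 2 by norm_num, h, mul_assoc (-1) (w / 2),
        mul_inv_cancel_left₀ hw2.ne']
      ring
    have hconst := isOpen_Ioi.is_const_of_deriv_eq_zero (convex_Ioi (0 : ℝ)).isPreconnected
      (fun w hw => (hd w hw).differentiableAt.differentiableWithinAt)
      (fun w hw => (hd w hw).deriv) (mem_Ioi.2 one_pos) (mem_Ioi.2 hz)
    simp only [tildeKHalf, Nat.cast_zero, zero_add]
    rw [hconst, mul_right_comm, ← Real.exp_add, add_neg_cancel, Real.exp_zero, one_mul]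
  | succ n ih =>
    have hd : deriv (tildeKHalf n) z = deriv (tildeK (-((n : ℝ) + 1 / 2))) z :=
      Filter.EventuallyEq.deriv_eq (by
        filter_upwards [Ioi_mem_nhds hz] with w hw using ih hw)
    simp only [tildeKHalf]
    rw [ih hz, hd, (hasDerivAt_tildeK _ hz).deriv,
      show (-(((n + 1 : ℕ) : ℝ) + 1 / 2)) = -((n : ℝ) + 1 / 2) - 1 by push_cast; ring,
      tildeK_sub_one _ hz]
    ring

theorem limUnder_iteratedDeriv_eq {f g : ℝ → ℝ} (hg : ContDiffAt ℝ ∞ g 0)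
    (h : ∀ t, 0 < t → t < 1 → f t = g t) (k : ℕ) :
    limUnder (𝓝[>] (0 : ℝ)) (fun t => iteratedDeriv k f t) = iteratedDeriv k g 0 := by
  refine Tendsto.limUnder_eq ?_
  refine ((hg.iteratedDeriv_of_infty k).continuousAt.tendsto.mono_left
    nhdsWithin_le_nhds).congr' ?_
  filter_upwards [Ioo_mem_nhdsGT (zero_lt_one' ℝ)] with t ht
  refine (Filter.EventuallyEq.iteratedDeriv_eq k ?_).symm
  filter_upwards [Ioo_mem_nhds ht.1 ht.2] with s hs using h s hs.1 hs.2

theorem pow_mul_tildeK_mul (n : ℕ) (ν : ℝ) (B : ℝ → ℝ) {t y : ℝ} (ht : 0 < t) (ht1 : t < 1)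
    (hy : 0 < y) :
    t ^ (2 * n + 1) * ((1 - t) ^ (-(((2 * n + 1 : ℕ) : ℝ) + ν + 2) / 2) *
        tildeK (((2 * n + 1 : ℕ) : ℝ) / 2) (t * y / (1 - t)) * B (y / (1 - t)))
      = (y / 2) ^ (-((2 * n + 1 : ℕ) : ℝ)) *
        bilinearGen (tildeKHalf n) B ((-(2 * (n : ℝ) + 1) + ν + 2) / 2) t y := by
  have h1 : 0 < 1 - t := sub_pos.2 ht1
  have hw : 0 < t * y / (1 - t) := by positivity
  have he : -(((2 * n + 1 : ℕ) : ℝ) + ν + 2) / 2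
      = -((-(2 * (n : ℝ) + 1) + ν + 2) / 2) - ((2 * n + 1 : ℕ) : ℝ) := by push_cast; ring
  rw [tildeK_eq_tildeK_neg _ hw, mul_div_cancel₀ _ (two_ne_zero' ℝ),
    show -(((2 * n + 1 : ℕ) : ℝ) / 2) = -((n : ℝ) + 1 / 2) by push_cast; ring,
    ← tildeKHalf_eq n hw, bilinearGen, he, Real.rpow_sub h1, Real.rpow_natCast,
    Real.rpow_neg (half_pos hw).le, Real.rpow_neg (half_pos hy).le, Real.rpow_natCast,
    Real.rpow_natCast, div_pow, div_pow, mul_pow, div_pow]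
  field_simp

theorem limUnder_iteratedDeriv_pow_mul_tildeK (n : ℕ) (ν : ℝ) {B : ℝ → ℝ}
    (hB : ContDiffOn ℝ ∞ B (Ioi 0)) {y : ℝ} (hy : 0 < y) (k : ℕ) :
    limUnder (𝓝[>] (0 : ℝ)) (fun t => iteratedDeriv k (fun s => s ^ (2 * n + 1) *
        ((1 - s) ^ (-(((2 * n + 1 : ℕ) : ℝ) + ν + 2) / 2) *
          tildeK (((2 * n + 1 : ℕ) : ℝ) / 2) (s * y / (1 - s)) * B (y / (1 - s)))) t) /
        (k.factorial : ℝ)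
      = (y / 2) ^ (-((2 * n + 1 : ℕ) : ℝ)) * taylorCoeff k (fun t =>
        bilinearGen (tildeKHalf n) B ((-(2 * (n : ℝ) + 1) + ν + 2) / 2) t y) := by
  have hg := contDiffAt_bilinearGen_fst (contDiff_tildeKHalf n) hB
    ((-(2 * (n : ℝ) + 1) + ν + 2) / 2) one_pos hy
  rw [limUnder_iteratedDeriv_eq (contDiffAt_const.mul hg)
    (fun t ht ht1 => pow_mul_tildeK_mul n ν B ht ht1 hy) k, ← taylorCoeff.const_mul]
  rfl

/-- The recurrence of `taylorCoeff_bilinearGen_recurrence` for a family indexed by `ℤ`, which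
starts at `-m` and is twisted by `(y/2)^{-m}`. -/
theorem recurrence_of_eq_taylorCoeff {A B : ℝ → ℝ} {μ ν : ℝ} {m : ℕ} {L : ℤ → ℝ → ℝ}
    (hm : (m : ℝ) * (μ - m) = 0)
    (hA : ContDiff ℝ ∞ A) (hB : ContDiffOn ℝ ∞ B (Ioi 0))
    (odeA : ∀ w, w * deriv (deriv A) w + (μ - 2 * m + 1) * deriv A w = w * A w)
    (odeB : ∀ z, 0 < z → z * deriv (deriv B) z + (ν + 1) * deriv B z = z * B z)
    {c : ℝ} (hc : c = (μ - 2 * m + ν + 2) / 2)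
    (hL : ∀ (k : ℕ) (y : ℝ), 0 < y → L (k - m) y =
      (y / 2) ^ (-(m : ℝ)) * taylorCoeff k (fun t => bilinearGen A B c t y))
    (hL0 : ∀ j : ℤ, j < -m → ∀ y, L j y = 0) (j : ℤ) {x : ℝ} (hx : 0 < x) :
    (2 * (j : ℝ) + μ + 1) * (x * deriv (fun y => L j y) x + (μ + ν + 2) / 2 * L j x)
      = ((j : ℝ) + 1) * ((j : ℝ) + μ + 1) * L (j + 1) x
        - ((j : ℝ) + (μ + ν) / 2) * ((j : ℝ) + (μ - ν) / 2) * L (j - 1) x := by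
  rcases lt_or_ge j (-m) with hj | hj
  · have hz : (fun y => L j y) = fun _ => 0 := funext (hL0 j hj)
    rw [hz, hL0 j hj, hL0 (j - 1) (by lia), deriv_const]
    rcases eq_or_ne (j + 1) (-m) with h | h
    · have hj' : (j : ℝ) = -m - 1 := by
        rw [eq_sub_iff_add_eq]
        exact_mod_cast h
      rw [hj']
      linear_combination L (j + 1) x * hm
    · rw [hL0 (j + 1) (by lia)]
      ring
  · obtain ⟨k, hk⟩ := Int.eq_ofNat_of_zero_le (show 0 ≤ j + m by lia)
    obtain rfl : j = k - m := by lia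
    have hg := contDiffAt_bilinearGen_fst hA hB c one_pos hx
    have hpred : L (k - m - 1) x = (x / 2) ^ (-(m : ℝ)) *
        taylorCoeff k (fun t => t * bilinearGen A B c t x) := by
      cases k with
      | zero => rw [hL0 _ (by lia), taylorCoeff.zero_id_mul, mul_zero]
      | succ k =>
        rw [taylorCoeff.succ_id_mul hg, ← hL k x hx]
        congr 1
        push_cast
        ring
    have hsucc : L (k - m + 1) x = (x / 2) ^ (-(m : ℝ)) *
        taylorCoeff (k + 1) (fun t => bilinearGen A B c t x) := by
      rw [← hL (k + 1) x hx]
      congr 1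
      push_cast
      ring
    have hT := (hasDerivAt_taylorCoeff_bilinearGen hA hB c hx k).differentiableAt.hasDerivAt
    have hd := ((((hasDerivAt_id' x).div_const 2).rpow_const (p := -(m : ℝ))
      (Or.inl (half_pos hx).ne')).fun_mul hT).congr_of_eventuallyEq
      (f₁ := fun y => L (k - m) y) (by
        filter_upwards [Ioi_mem_nhds hx] with y hy using hL k y hy)
    have hrec := taylorCoeff_bilinearGen_recurrence hA hB odeA odeB hc hx k
    rw [hd.deriv, hpred, hsucc, hL k x hx, Real.rpow_sub_one (half_pos hx).ne']
    subst hc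
    generalize deriv (fun y => taylorCoeff k _) x = T' at hrec ⊢
    generalize (x / 2) ^ (-(m : ℝ)) = P
    have hx' : x * (P / (x / 2)) = 2 * P := by field_simp
    push_cast
    linear_combination P * hrec
      + P * taylorCoeff (k + 1) (fun t => bilinearGen A B ((μ - 2 * m + ν + 2) / 2) t x) * hm
      - (2 * (k - m : ℝ) + μ + 1) * (m / 2)
        * taylorCoeff k (fun t => bilinearGen A B ((μ - 2 * m + ν + 2) / 2) t x) * hx'

/-- Recurrence relation `(2j+μ+1)·(θ + (μ+ν+2)/2)Λ_{i,j}^{μ,ν}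
= (j+1)(j+μ+1)·Λ_{i,j+1}^{μ,ν} − (j+(μ+ν)/2)(j+(μ−ν)/2)·Λ_{i,j−1}^{μ,ν}` for `i ∈ {1,2}`
and every `j ∈ ℤ`, and likewise for `i ∈ {3,4}` when `μ` is a positive odd integer. -/
theorem statement16 (μ ν : ℝ) :
    (∀ j : ℤ, ∀ x : ℝ, 0 < x →
      ((2 * (j : ℝ) + μ + 1) *
          (x * deriv (fun y => Lambda₁Z μ ν j y) x + (μ + ν + 2) / 2 * Lambda₁Z μ ν j x)
        = ((j : ℝ) + 1) * ((j : ℝ) + μ + 1) * Lambda₁Z μ ν (j + 1) x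
          - ((j : ℝ) + (μ + ν) / 2) * ((j : ℝ) + (μ - ν) / 2) * Lambda₁Z μ ν (j - 1) x) ∧
      ((2 * (j : ℝ) + μ + 1) *
          (x * deriv (fun y => Lambda₂Z μ ν j y) x + (μ + ν + 2) / 2 * Lambda₂Z μ ν j x)
        = ((j : ℝ) + 1) * ((j : ℝ) + μ + 1) * Lambda₂Z μ ν (j + 1) x
          - ((j : ℝ) + (μ + ν) / 2) * ((j : ℝ) + (μ - ν) / 2) * Lambda₂Z μ ν (j - 1) x)) ∧
    (∀ m : ℕ, Odd m → 0 < m → μ = (m : ℝ) → ∀ j : ℤ, ∀ x : ℝ, 0 < x →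
      ((2 * (j : ℝ) + μ + 1) *
          (x * deriv (fun y => Lambda₃ m ν j y) x + (μ + ν + 2) / 2 * Lambda₃ m ν j x)
        = ((j : ℝ) + 1) * ((j : ℝ) + μ + 1) * Lambda₃ m ν (j + 1) x
          - ((j : ℝ) + (μ + ν) / 2) * ((j : ℝ) + (μ - ν) / 2) * Lambda₃ m ν (j - 1) x) ∧
      ((2 * (j : ℝ) + μ + 1) *
          (x * deriv (fun y => Lambda₄ m ν j y) x + (μ + ν + 2) / 2 * Lambda₄ m ν j x)
        = ((j : ℝ) + 1) * ((j : ℝ) + μ + 1) * Lambda₄ m ν (j + 1) x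
          - ((j : ℝ) + (μ + ν) / 2) * ((j : ℝ) + (μ - ν) / 2) * Lambda₄ m ν (j - 1) x)) := by
  have odeI (α z : ℝ) : z * deriv (deriv (tildeI (α / 2))) z + (α + 1) * deriv (tildeI (α / 2)) z
      = z * tildeI (α / 2) z := by
    have h := tildeI_ode (α / 2) z
    rwa [mul_div_cancel₀ _ (two_ne_zero' ℝ)] at h
  have odeK (α z : ℝ) (hz : 0 < z) : z * deriv (deriv (tildeK (α / 2))) z
      + (α + 1) * deriv (tildeK (α / 2)) z = z * tildeK (α / 2) z := by
    have h := tildeK_ode (α / 2) hz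
    rwa [mul_div_cancel₀ _ (two_ne_zero' ℝ)] at h
  constructor
  · have hcase {B : ℝ → ℝ} (hB : ContDiffOn ℝ ∞ B (Ioi 0))
        (odeB : ∀ z, 0 < z → z * deriv (deriv B) z + (ν + 1) * deriv B z = z * B z)
        {L : ℤ → ℝ → ℝ}
        (hL : ∀ (k : ℕ) (y : ℝ), L k y = taylorCoeff k (fun t => (1 - t) ^ (-(μ + ν + 2) / 2) *
          tildeI (μ / 2) (t * y / (1 - t)) * B (y / (1 - t))))
        (hL0 : ∀ j : ℤ, j < 0 → ∀ y, L j y = 0) :=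
      recurrence_of_eq_taylorCoeff (L := L) (m := 0) (μ := μ) (ν := ν) (by simp)
        (contDiff_tildeI (μ / 2)) hB (by simpa using odeI μ) odeB (c := (μ + ν + 2) / 2)
        (by simp) (fun k y _ => by
          simp only [Nat.cast_zero, sub_zero, neg_zero, Real.rpow_zero, one_mul, hL, bilinearGen,
            neg_div]) (by simpa using hL0)
    refine fun j x hx => ⟨?_, ?_⟩
    · exact hcase (L := Lambda₁Z μ ν) (contDiff_tildeI (ν / 2)).contDiffOn (fun z _ => odeI ν z)
        (fun k y => if_pos (Int.natCast_nonneg k)) (fun j hj y => if_neg (not_le.2 hj)) j hx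
    · exact hcase (L := Lambda₂Z μ ν) (contDiffOn_tildeK (ν / 2)) (odeK ν)
        (fun k y => if_pos (Int.natCast_nonneg k)) (fun j hj y => if_neg (not_le.2 hj)) j hx
  · rintro _ ⟨n, rfl⟩ - rfl
    have hcase {B : ℝ → ℝ} (hB : ContDiffOn ℝ ∞ B (Ioi 0))
        (odeB : ∀ z, 0 < z → z * deriv (deriv B) z + (ν + 1) * deriv B z = z * B z)
        {L : ℤ → ℝ → ℝ}
        (hL : ∀ (k : ℕ) (y : ℝ), L (k - (2 * n + 1 : ℕ)) y =
          limUnder (𝓝[>] (0 : ℝ)) (fun t => iteratedDeriv k (fun s => s ^ (2 * n + 1) *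
            ((1 - s) ^ (-(((2 * n + 1 : ℕ) : ℝ) + ν + 2) / 2) *
              tildeK (((2 * n + 1 : ℕ) : ℝ) / 2) (s * y / (1 - s)) * B (y / (1 - s)))) t) /
            (k.factorial : ℝ))
        (hL0 : ∀ j : ℤ, j < -(2 * n + 1 : ℕ) → ∀ y, L j y = 0) :=
      have hμ : ((2 * n + 1 : ℕ) : ℝ) - 2 * (2 * n + 1 : ℕ) = -(2 * (n : ℝ) + 1) := by
        push_cast
        ring
      recurrence_of_eq_taylorCoeff (L := L) (m := 2 * n + 1) (μ := (2 * n + 1 : ℕ)) (ν := ν)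
        (by simp) (contDiff_tildeKHalf n) hB (by rw [hμ]; exact tildeKHalf_ode n) odeB rfl
        (fun k y hy => by
          rw [hL, hμ]
          exact limUnder_iteratedDeriv_pow_mul_tildeK n ν hB hy k) hL0
    refine fun j x hx => ⟨?_, ?_⟩
    · refine hcase (L := Lambda₃ (2 * n + 1) ν) (contDiff_tildeI (ν / 2)).contDiffOn
        (fun z _ => odeI ν z) (fun k y => ?_) (fun j hj y => if_neg (not_le.2 hj)) j hx
      rw [Lambda₃, if_pos (by lia), sub_add_cancel, Int.toNat_natCast]
      rfl
    · refine hcase (L := Lambda₄ (2 * n + 1) ν) (contDiffOn_tildeK (ν / 2)) (odeK ν)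
        (fun k y => ?_) (fun j hj y => if_neg (not_le.2 hj)) j hx
      rw [Lambda₄, if_pos (by lia), sub_add_cancel, Int.toNat_natCast]
      rfl
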